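/- Let m ≥ 4 and p ≥ 3 be integers and let G be a finite simple graph whose vertex set is partitioned into p parts V_1, …, V_p, each of size q, such that: (i) each induced subgraph G[V_i] is m-regular and m-connected; (ii) every vertex of V_i has exactly two neighbours of G outside V_i ('outside neighbours'), and these two outside neighbours lie in two distinct parts other than V_i; (iii) for any two distinct parts V_i and V_j the number of edges of G between V_i and V_j equals 2q/(p−1), and 2q/(p−1) ≥ m + 2. Let H be the subgraph of G induced on V_i ∪ V_j for some i ≠ j, and let x ∈ V_i and y ∈ V_j with d_H(x) = d_H(y) = m + 1. Then there exist m + 1 internally disjoint paths between x and y in H. -/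

import Mathlib

/-- A graph `G` is `k`-connected if it has more than `k` vertices and removing any set of
fewer than `k` vertices leaves a connected graph (equivalently, `κ(G) ≥ k`). -/
def IsKConnected {V : Type*} [Fintype V] (k : ℕ) (G : SimpleGraph V) : Prop :=
  k < Fintype.card V ∧ ∀ D : Set V, D.ncard < k → (G.induce Dᶜ).Connected

/-- There exist `k` pairwise internally disjoint paths between `x` and `y` in `G`. -/
def InternallyDisjointPaths {V : Type*} (G : SimpleGraph V) (k : ℕ) (x y : V) : Prop :=
  ∃ P : Fin k → G.Walk x y, (∀ i, (P i).IsPath) ∧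
    ∀ i j, i ≠ j → ∀ v, v ∈ (P i).support → v ∈ (P j).support → v = x ∨ v = y

open SimpleGraph

/-- Every walk of `G` from `A` to `B` meets `S`. -/
def Separates {V : Type*} (G : SimpleGraph V) (A B : Set V) (S : Finset V) : Prop :=
  ∀ ⦃a b : V⦄, a ∈ A → b ∈ B → ∀ w : G.Walk a b, ∃ v ∈ w.support, v ∈ S

/-- There are `k` pairwise vertex-disjoint walks of `G` from `A` to `B`. -/
def HasDisjointWalks {V : Type*} (G : SimpleGraph V) (A B : Set V) (k : ℕ) : Prop :=
  ∃ (a b : Fin k → V) (w : ∀ i, G.Walk (a i) (b i)), (∀ i, a i ∈ A) ∧ (∀ i, b i ∈ B) ∧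
    ∀ i j, i ≠ j → ∀ v ∈ (w i).support, v ∉ (w j).support

section Menger

variable {V : Type*} {G : SimpleGraph V}

theorem Separates.symm {A B : Set V} {S : Finset V} (h : Separates G A B S) :
    Separates G B A S := by
  intro a b ha hb w
  simpa using h hb ha w.reverse

/-- A walk can be cut at its first vertex in `B`. -/
theorem SimpleGraph.Walk.exists_first_hit (B : Set V) {a b : V} (w : G.Walk a b)
    (hw : ∃ v ∈ w.support, v ∈ B) :
    ∃ c ∈ B, ∃ w' : G.Walk a c, w'.support ⊆ w.support ∧ (∀ v ∈ w'.support, v ∈ B → v = c) ∧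
      ∀ v ∈ w'.support, ∃ u : G.Walk a v, u.support ⊆ w'.support ∧
        ∀ z ∈ u.support, z ∈ B → z = v := by
  induction w with
  | nil =>
    obtain ⟨v, hv, hvB⟩ := hw
    obtain rfl : v = _ := by simpa using hv
    refine ⟨v, hvB, .nil, by simp, by simp, ?_⟩
    intro z hz
    obtain rfl : z = v := by simpa using hz
    exact ⟨.nil, by simp, by simp⟩
  | @cons a d e h t ih =>
    by_cases haB : a ∈ B
    · refine ⟨a, haB, .nil, by simp, by simp, ?_⟩
      intro z hz
      obtain rfl : z = a := by simpa using hz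
      exact ⟨.nil, by simp, by simp⟩
    · obtain ⟨c, hc, t', hsub, huniq, hseg⟩ := ih (by
        obtain ⟨v, hv, hvB⟩ := hw
        rw [Walk.support_cons, List.mem_cons] at hv
        rcases hv with rfl | hv
        · exact absurd hvB haB
        · exact ⟨v, hv, hvB⟩)
      refine ⟨c, hc, .cons h t', ?_, ?_, ?_⟩
      · rw [Walk.support_cons, Walk.support_cons]
        exact List.cons_subset_cons _ hsub
      · intro v hv hvB
        rw [Walk.support_cons, List.mem_cons] at hv
        rcases hv with rfl | hv
        · exact absurd hvB haB
        · exact huniq v hv hvB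
      · intro v hv
        rw [Walk.support_cons, List.mem_cons] at hv
        rcases hv with rfl | hv
        · exact ⟨.nil, by simp, by simp⟩
        · obtain ⟨u, hu, huB⟩ := hseg v hv
          refine ⟨.cons h u, ?_, ?_⟩
          · rw [Walk.support_cons, Walk.support_cons]
            exact List.cons_subset_cons _ hu
          · intro z hz hzB
            rw [Walk.support_cons, List.mem_cons] at hz
            rcases hz with rfl | hz
            · exact absurd hzB haB
            · exact huB z hz hzB

theorem SimpleGraph.Walk.exists_deleteEdges {a b x y : V} (w : G.Walk a b)
    (hw : s(x, y) ∉ w.edges) :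
    ∃ w' : (G.deleteEdges {s(x, y)}).Walk a b, w'.support = w.support :=
  ⟨w.toDeleteEdge s(x, y) hw, by simp [Walk.toDeleteEdge, Walk.toDeleteEdges]⟩

theorem SimpleGraph.Walk.exists_deleteEdges_of_notMem {a b x y : V} (w : G.Walk a b)
    (hw : x ∉ w.support) :
    ∃ w' : (G.deleteEdges {s(x, y)}).Walk a b, w'.support = w.support :=
  w.exists_deleteEdges fun h => hw (w.fst_mem_support_of_mem_edges h)

theorem Separates.insert_of_deleteEdges [DecidableEq V] {A B : Set V} {S : Finset V} {x y : V}
    (h : Separates (G.deleteEdges {s(x, y)}) A B S) : Separates G A B (insert x S) := by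
  intro a b ha hb w
  by_cases hx : x ∈ w.support
  · exact ⟨x, hx, by simp⟩
  · obtain ⟨w', hw'⟩ := w.exists_deleteEdges_of_notMem (y := y) hx
    obtain ⟨v, hv, hvS⟩ := h ha hb w'
    exact ⟨v, hw' ▸ hv, by simp [hvS]⟩

/-- If `y` cannot be reached from `A` in `G - xy - S`, then separating `A` from `S ∪ {x}` in
`G - xy` is enough to separate `A` from `B` in `G`. -/
theorem Separates.of_insert [DecidableEq V] {A B : Set V} {S T : Finset V} {x y : V}
    (hxy : x ≠ y) (hyS : y ∉ S) (hS : Separates (G.deleteEdges {s(x, y)}) A B S)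
    (hy : Separates (G.deleteEdges {s(x, y)}) A {y} S)
    (hT : Separates (G.deleteEdges {s(x, y)}) A (insert x S : Finset V) T) :
    Separates G A B T := by
  intro a b ha hb w
  obtain ⟨c, hc, w', hsub, huniq, hseg⟩ :=
    w.exists_first_hit (insert x S : Finset V) (hS.insert_of_deleteEdges ha hb w)
  have he : s(x, y) ∉ w'.edges := by
    intro he
    have hyw := w'.snd_mem_support_of_mem_edges he
    obtain ⟨u, -, hu⟩ := hseg y hyw
    have hu' : ∀ z ∈ u.support, z ∉ insert x S := by
      intro z hz hzP
      obtain rfl := hu z hz hzP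
      rcases Finset.mem_insert.1 hzP with h | h
      · exact hxy h.symm
      · exact hyS h
    obtain ⟨u', hu''⟩ := u.exists_deleteEdges_of_notMem (x := x) (y := y)
      fun h => hu' x h (by simp)
    obtain ⟨z, hz, hzS⟩ := hy ha rfl u'
    exact hu' z (hu'' ▸ hz) (by simp [hzS])
  obtain ⟨u, hu⟩ := w'.exists_deleteEdges he
  obtain ⟨v, hv, hvT⟩ := hT ha hc u
  exact ⟨v, hsub (hu ▸ hv), hvT⟩

/-- A disjoint family of walks from `A` to a set `P` of the same size can be chosen so that each
walk meets `P` only at its end and every vertex of `P` is an end. -/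
theorem HasDisjointWalks.exists_trimmed {A : Set V} {P : Finset V} {k : ℕ}
    (h : HasDisjointWalks G A P k) (hP : P.card = k) :
    ∃ (a c : Fin k → V) (w : ∀ i, G.Walk (a i) (c i)), (∀ i, a i ∈ A) ∧ (∀ i, c i ∈ P) ∧
      (∀ z ∈ P, ∃ i, c i = z) ∧
      (∀ i j, i ≠ j → ∀ v ∈ (w i).support, v ∉ (w j).support) ∧
      (∀ i, ∀ v ∈ (w i).support, v ∈ P → v = c i) ∧
      ∀ i, ∀ v ∈ (w i).support, ∃ u : G.Walk (a i) v, ∀ z ∈ u.support, z ∈ P → z = v := by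
  obtain ⟨a, b, w, ha, hb, hd⟩ := h
  choose c hc w' hsub huniq hseg using fun i =>
    (w i).exists_first_hit (P : Set V) ⟨b i, by simp, hb i⟩
  have hd' : ∀ i j, i ≠ j → ∀ v ∈ (w' i).support, v ∉ (w' j).support :=
    fun i j hij v hv hv' => hd i j hij v (hsub i hv) (hsub j hv')
  have hinj : Function.Injective c := by
    intro i j hij
    by_contra hne
    exact hd' i j hne (c i) (by simp) (by rw [hij]; simp)
  refine ⟨a, c, w', ha, fun i => by simpa using hc i, ?_, hd', huniq, ?_⟩
  · have := Finset.surj_on_of_inj_on_of_card_le (s := Finset.univ) (t := P) (fun i _ => c i)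
      (fun i _ => by simpa using hc i) (fun i j _ _ h => hinj h) (by simp [hP])
    intro z hz
    obtain ⟨i, -, hi⟩ := this z hz
    exact ⟨i, hi.symm⟩
  · intro i v hv
    obtain ⟨u, -, hu⟩ := hseg i v hv
    exact ⟨u, hu⟩

/-- **Menger's theorem**, for disjoint walks between two sets of vertices. -/
theorem hasDisjointWalks_of_separates [Finite V] (k : ℕ) (G : SimpleGraph V) :
    ∀ A B : Set V, (∀ S : Finset V, Separates G A B S → k ≤ S.card) →
      HasDisjointWalks G A B k := by
  classical
  induction G using WellFoundedLT.induction with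
  | _ G ih =>
  intro A B hk
  by_cases hE : ∃ x y, G.Adj x y
  swap
  · have hfin : (A ∩ B).Finite := Set.toFinite _
    have := hk hfin.toFinset (by
      intro a b ha hb w
      cases w with
      | nil => exact ⟨a, by simp, by simp [ha, hb]⟩
      | cons h _ => exact absurd ⟨_, _, h⟩ hE)
    obtain ⟨T, hT, hTk⟩ := Finset.exists_subset_card_eq this
    let f := (Finset.equivFinOfCardEq hTk).symm
    have hf : ∀ i, (f i : V) ∈ A ∩ B := fun i => by simpa using hT (f i).2
    refine ⟨fun i => f i, fun i => f i, fun i => .nil, fun i => (hf i).1, fun i => (hf i).2, ?_⟩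
    intro i j hij v hv hv'
    simp only [Walk.support_nil, List.mem_singleton] at hv hv'
    exact hij (f.injective (Subtype.ext (hv.symm.trans hv')))
  obtain ⟨x₀, y₀, hadj₀⟩ := hE
  by_cases hk' : ∀ S : Finset V, Separates (G.deleteEdges {s(x₀, y₀)}) A B S → k ≤ S.card
  · obtain ⟨a, b, w, ha, hb, hd⟩ := ih _ (by
      refine lt_of_le_of_ne (G.deleteEdges_le _) fun h => ?_
      have := h ▸ hadj₀
      simp at this) A B hk'
    exact ⟨a, b, fun i => (w i).mapLe (G.deleteEdges_le _), ha, hb, by simpa using hd⟩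
  push Not at hk'
  obtain ⟨S, hS, hSk⟩ := hk'
  obtain ⟨a₀, b₀, ha₀, hb₀, w₀, hw₀⟩ : ∃ a b, ∃ (_ : a ∈ A) (_ : b ∈ B) (w : G.Walk a b),
      ∀ v ∈ w.support, v ∉ S := by
    by_contra! h
    exact absurd (hk S fun a b ha hb w => h a b ha hb w) (by omega)
  let R : Set V := {v | ∃ a ∈ A, ∃ w : (G.deleteEdges {s(x₀, y₀)}).Walk a v,
    ∀ z ∈ w.support, z ∉ S}
  obtain ⟨d, hd, hdR, hdR'⟩ := w₀.exists_boundary_dart R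
    ⟨a₀, ha₀, .nil, by simpa using hw₀ a₀ (by simp)⟩ (by
      rintro ⟨a, ha, w, hw⟩
      obtain ⟨v, hv, hvS⟩ := hS ha hb₀ w
      exact hw v hv hvS)
  obtain ⟨⟨x, y⟩, hadj⟩ := d
  have hyS : y ∉ S := hw₀ _ (w₀.dart_snd_mem_support_of_mem_darts hd)
  have hxS : x ∉ S := hw₀ _ (w₀.dart_fst_mem_support_of_mem_darts hd)
  simp only at hdR hdR' hadj
  have hedge : s(x₀, y₀) = s(x, y) := by
    by_contra hne
    obtain ⟨a, ha, w, hw⟩ := hdR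
    have hadj' : (G.deleteEdges {s(x₀, y₀)}).Adj x y := by
      rw [deleteEdges_adj]
      exact ⟨hadj, fun h => hne (Set.mem_singleton_iff.1 h).symm⟩
    refine hdR' ⟨a, ha, w.concat hadj', ?_⟩
    intro z hz
    rw [Walk.support_concat, List.mem_append] at hz
    rcases hz with hz | hz
    · exact hw z hz
    · obtain rfl : z = y := by simpa using hz
      exact hyS
  change ∃ a ∈ A, ∃ w : (G.deleteEdges {s(x₀, y₀)}).Walk a x, ∀ z ∈ w.support, z ∉ S at hdR
  change ¬ ∃ a ∈ A, ∃ w : (G.deleteEdges {s(x₀, y₀)}).Walk a y, ∀ z ∈ w.support, z ∉ S at hdR'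
  clear R
  rw [hedge] at hS hdR hdR'
  clear hd hw₀ w₀ hb₀ ha₀ hadj₀ hedge
  have hxy := hadj.ne
  have hlt : G.deleteEdges {s(x, y)} < G := by
    refine lt_of_le_of_ne (G.deleteEdges_le _) fun h => ?_
    have := h ▸ hadj
    simp at this
  have hyA : Separates (G.deleteEdges {s(x, y)}) A {y} S := by
    rintro a _ ha rfl w
    by_contra! h
    exact hdR' ⟨a, ha, w, h⟩
  have hxB : Separates (G.deleteEdges {s(x, y)}) B {x} S := by
    rintro b _ hb rfl w
    obtain ⟨a, ha, u, hu⟩ := hdR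
    obtain ⟨v, hv, hvS⟩ := hS ha hb (u.append w.reverse)
    rw [Walk.mem_support_append_iff] at hv
    rcases hv with hv | hv
    · exact absurd hvS (hu v hv)
    · exact ⟨v, by simpa using hv, hvS⟩
  have hle : G.deleteEdges {s(x, y)} ≤ G := G.deleteEdges_le _
  have hPk : (insert x S).card = k := le_antisymm
    ((Finset.card_insert_le _ _).trans (by omega)) (hk _ hS.insert_of_deleteEdges)
  have hQk : (insert y S).card = k := by
    rw [Finset.card_insert_of_notMem hyS, ← hPk, Finset.card_insert_of_notMem hxS]
  obtain ⟨a, c, w, ha, hc, -, hwd, hwP, hws⟩ :=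
    (ih _ hlt A (insert x S : Finset V) fun T hT =>
      hk T (.of_insert hxy hyS hS hyA hT)).exists_trimmed hPk
  obtain ⟨b, e, u, hb, he, hsurj, hud, huQ, hus⟩ :=
    (ih _ hlt B (insert y S : Finset V) fun T hT => hk T (Separates.symm (by
      rw [Sym2.eq_swap] at hT hxB hS
      exact .of_insert hxy.symm hxS hS.symm hxB hT))).exists_trimmed hQk
  have hmeet : ∀ i j, ∀ v ∈ (w i).support, v ∈ (u j).support → v ∈ S := by
    intro i j v hv hv'
    obtain ⟨w', hw'⟩ := hws i v hv
    obtain ⟨u', hu'⟩ := hus j v hv'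
    obtain ⟨z, hz, hzS⟩ := hS (ha i) (hb j) (w'.append u'.reverse)
    rw [Walk.mem_support_append_iff] at hz
    have : z = v := by
      rcases hz with hz | hz
      · exact hw' z hz (by simp [hzS])
      · exact hu' z (by simpa using hz) (by simp [hzS])
    exact this ▸ hzS
  have hglue : ∀ i, ∃ j, (c i ∈ S → e j = c i) ∧ (c i ∉ S → e j = y) ∧
      ∃ g : G.Walk (a i) (b j), ∀ v ∈ g.support, v ∈ (w i).support ∨ v ∈ (u j).support := by
    intro i
    by_cases hi : c i ∈ S
    · obtain ⟨j, hj⟩ := hsurj (c i) (by simp [hi])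
      refine ⟨j, fun _ => hj, fun h => absurd hi h,
        ((w i).mapLe hle).append (((u j).reverse.mapLe hle).copy hj rfl), ?_⟩
      intro v hv
      rw [Walk.mem_support_append_iff] at hv
      simpa using hv
    · obtain ⟨j, hj⟩ := hsurj y (by simp)
      have hcx : c i = x := (Finset.mem_insert.1 (hc i)).resolve_right hi
      refine ⟨j, fun h => absurd h hi, fun _ => hj,
        ((w i).mapLe hle).append (.cons (by rw [hcx, hj]; exact hadj)
          ((u j).reverse.mapLe hle)), ?_⟩
      intro v hv
      rw [Walk.mem_support_append_iff, Walk.support_cons, List.mem_cons] at hv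
      rcases hv with hv | rfl | hv
      · exact Or.inl (by simpa using hv)
      · exact Or.inl (by simp)
      · exact Or.inr (by simpa using hv)
  choose σ hσS hσy g hg using hglue
  have hcinj : ∀ i j, i ≠ j → c i ≠ c j := fun i j hij h =>
    hwd i j hij (c i) (by simp) (by rw [h]; simp)
  have hσ : ∀ i j, i ≠ j → σ i ≠ σ j := by
    intro i j hij h
    apply hcinj i j hij
    by_cases hi : c i ∈ S <;> by_cases hj : c j ∈ S
    · rw [← hσS i hi, ← hσS j hj, h]
    · exact absurd (by rwa [← hσy j hj, ← h, hσS i hi]) hyS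
    · exact absurd (by rwa [← hσy i hi, h, hσS j hj]) hyS
    · rw [(Finset.mem_insert.1 (hc i)).resolve_right hi,
        (Finset.mem_insert.1 (hc j)).resolve_right hj]
  have hcross : ∀ i j, i ≠ j → ∀ v ∈ (w i).support, v ∉ (u (σ j)).support := by
    intro i j hij v hv hv'
    have hvS := hmeet i _ v hv hv'
    have h₁ := hwP i v hv (by simp [hvS])
    have h₂ := huQ _ v hv' (by simp [hvS])
    by_cases hj : c j ∈ S
    · exact hcinj i j hij (by rw [← h₁, h₂, hσS j hj])
    · exact hyS (by rw [← hσy j hj, ← h₂]; exact hvS)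
  refine ⟨a, fun i => b (σ i), g, ha, fun i => hb _, ?_⟩
  intro i j hij v hv hv'
  rcases hg i v hv with h | h <;> rcases hg j v hv' with h' | h'
  · exact hwd i j hij v h h'
  · exact hcross i j hij v h h'
  · exact hcross j i hij.symm v h' h
  · exact hud _ _ (hσ i j hij) v h h'

/-- A walk ending at `y` and avoiding `x` can be stopped just before `y`. -/
theorem SimpleGraph.Walk.exists_stop_before {x a y : V} (w : G.Walk a y) (hx : x ∉ w.support)
    (ha : a ≠ y) :
    ∃ b, G.Adj b y ∧ ∃ w' : (G.induce {x, y}ᶜ).spanningCoe.Walk a b, w'.support ⊆ w.support := by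
  induction w with
  | nil => exact absurd rfl ha
  | @cons a c y h t ih =>
    rw [Walk.support_cons, List.mem_cons, not_or] at hx
    by_cases hc : c = y
    · subst hc
      exact ⟨a, h, .nil, by simp⟩
    · obtain ⟨b, hb, w', hw'⟩ := ih hx.2 hc
      have hcx : c ≠ x := fun h => hx.2 (by simp [← h])
      refine ⟨b, hb, .cons (v := c) ?_ w', ?_⟩
      · simpa [h, ha, hc, hcx] using fun h' => hx.1 h'.symm
      · rw [Walk.support_cons, Walk.support_cons]
        exact List.cons_subset_cons _ hw'

theorem SimpleGraph.Walk.support_subset_of_induce {s : Set V} {a b : V}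
    (w : (G.induce s).spanningCoe.Walk a b) (ha : a ∈ s) : ∀ v ∈ w.support, v ∈ s := by
  induction w with
  | nil => simpa using ha
  | cons h t ih =>
    rw [Walk.support_cons, List.forall_mem_cons]
    refine ⟨ha, ih ?_⟩
    simp only [map_adj, comap_adj, Function.Embedding.subtype_apply] at h
    obtain ⟨_, v, -, -, rfl⟩ := h
    exact v.2

/-- **Menger's theorem**, for internally disjoint paths between two nonadjacent vertices. -/
theorem internallyDisjointPaths_of_separators [Finite V] {k : ℕ} {x y : V} (hxy : x ≠ y)
    (hadj : ¬ G.Adj x y)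
    (h : ∀ S : Finset V, S.card < k → x ∉ S → y ∉ S →
      ∃ w : G.Walk x y, ∀ v ∈ w.support, v ∉ S) :
    InternallyDisjointPaths G k x y := by
  classical
  have hnbr : ∀ a, G.Adj x a → a ∈ ({x, y}ᶜ : Set V) := by
    rintro a ha (rfl | rfl)
    · exact ha.ne rfl
    · exact hadj ha
  have hmenger := hasDisjointWalks_of_separates k
      (G.induce {x, y}ᶜ).spanningCoe {a | G.Adj x a} {b | G.Adj b y} (by
    intro S hS
    by_contra! hk
    obtain ⟨w, hw⟩ := h (S \ {x, y}) ((Finset.card_le_card Finset.sdiff_subset).trans_lt hk)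
      (by simp) (by simp)
    have hp := w.bypass_isPath
    have hsub : ∀ v ∈ w.bypass.support, v ∉ S \ {x, y} :=
      fun v hv => hw v (w.support_bypass_subset_support hv)
    generalize w.bypass = p at hp hsub
    cases p with
    | nil => exact hxy rfl
    | @cons _ c _ h t =>
      rw [Walk.cons_isPath_iff] at hp
      obtain ⟨b, hb, w', hw'⟩ := t.exists_stop_before hp.2 (fun hc => hadj (hc ▸ h))
      obtain ⟨v, hv, hvS⟩ := hS h hb w'
      have hvxy := w'.support_subset_of_induce (hnbr c h) v hv
      exact hsub v (by simpa using Or.inr (hw' hv)) (by simpa [hvS] using hvxy))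
  obtain ⟨a, b, w, ha, hb, hd⟩ := hmenger
  have hle : (G.induce {x, y}ᶜ).spanningCoe ≤ G := G.spanningCoe_induce_le _
  let P : ∀ i, G.Walk x y := fun i => .cons (ha i) (((w i).mapLe hle).concat (hb i))
  refine ⟨fun i => (P i).bypass, fun i => (P i).bypass_isPath, ?_⟩
  have hP : ∀ i, ∀ v ∈ (P i).bypass.support, v = x ∨ v = y ∨ v ∈ (w i).support := by
    intro i v hv
    have := (P i).support_bypass_subset_support hv
    simp only [P, Walk.support_cons, Walk.support_concat, Walk.support_mapLe_eq_support,
      List.mem_cons, List.mem_append] at this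
    tauto
  intro i j hij v hv hv'
  have h₁ := hP i v hv
  have h₂ := hP j v hv'
  have h₃ := hd i j hij v
  tauto

end Menger

/-- Two vertices of a set `s` inducing an `m`-connected graph stay connected, in a larger induced
graph, after deleting a set with fewer than `m` vertices in `s`. -/
theorem IsKConnected.exists_walk {V : Type*} {G : SimpleGraph V} {s W : Set V}
    [Fintype s] [Finite W] {m : ℕ} (hs : IsKConnected m (G.induce s)) (hsW : s ⊆ W) {T : Set W}
    (hT : {v | v ∈ T ∧ (v : V) ∈ s}.ncard < m) {u v : W} (hu : (u : V) ∈ s) (hv : (v : V) ∈ s)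
    (huT : u ∉ T) (hvT : v ∉ T) :
    ∃ w : (G.induce W).Walk u v, ∀ z ∈ w.support, z ∉ T := by
  let f : s → W := Set.inclusion hsW
  have hc := hs.2 (f ⁻¹' T) <| (Set.ncard_le_ncard_of_injOn (s := f ⁻¹' T)
    (t := {v | v ∈ T ∧ (v : V) ∈ s}) f (fun v hv => ⟨hv, v.2⟩)
    (Set.inclusion_injective hsW).injOn).trans_lt hT
  let φ : (G.induce s).induce (f ⁻¹' T)ᶜ →g G.induce W := ⟨fun v => f v, fun h => h⟩
  obtain ⟨w⟩ := hc.preconnected ⟨⟨u, hu⟩, huT⟩ ⟨⟨v, hv⟩, hvT⟩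
  refine ⟨w.map φ, ?_⟩
  intro z hz
  rw [Walk.support_map, List.mem_map] at hz
  obtain ⟨z, -, rfl⟩ := hz
  exact z.2

/-- Deleting fewer vertices than there are independent edges leaves one of the edges intact. -/
theorem exists_edge_of_ncard_lt {V : Type*} {E : Set (V × V)} {T : Set V}
    [Finite V] (hT : T.ncard < E.ncard)
    (h₁ : ∀ e ∈ E, ∀ e' ∈ E, e.1 = e'.1 → e = e') (h₂ : ∀ e ∈ E, ∀ e' ∈ E, e.2 = e'.2 → e = e')
    (h₁₂ : ∀ e ∈ E, ∀ e' ∈ E, e.1 ≠ e'.2) :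
    ∃ e ∈ E, e.1 ∉ T ∧ e.2 ∉ T := by
  classical
  by_contra! h
  refine absurd (Set.ncard_le_ncard_of_injOn (fun e : V × V => if e.1 ∈ T then e.1 else e.2)
    (s := E) (t := T) ?_ ?_) (by omega)
  · intro e he
    split_ifs with heT
    · exact heT
    · exact h e he heT
  · intro e he e' he' hee
    dsimp only at hee
    split_ifs at hee
    · exact h₁ e he e' he' hee
    · exact absurd hee (h₁₂ e he e' he')
    · exact absurd hee.symm (h₁₂ e' he' e he)
    · exact h₂ e he e' he' hee

/-- A vertex of degree greater than `m` in `G[W]` with only `m` neighbours in its own part has a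
neighbour in `W` outside its part. -/
theorem exists_adj_of_ncard_lt {V ι : Type*} [Finite V] {G : SimpleGraph V} {W : Set V}
    (part : V → ι) {m : ℕ} (x : W) (h : {w : V | G.Adj x w ∧ part w = part x}.ncard = m)
    (hx : m < ((G.induce W).neighborSet x).ncard) :
    ∃ x', (G.induce W).Adj x x' ∧ part (x' : V) ≠ part x := by
  by_contra! hc
  have := Set.ncard_le_ncard_of_injOn (s := (G.induce W).neighborSet x)
    (t := {w : V | G.Adj x w ∧ part w = part x}) (fun v : W => (v : V))
    (fun v hv => ⟨hv, hc v hv⟩) Subtype.val_injective.injOn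
  omega

/-- with the same partitioned-graph set-up, if `H` is induced on the union of
two distinct parts `V_i ∪ V_j`, and `x ∈ V_i`, `y ∈ V_j` both have degree `m + 1` in `H`,
then there exist `m + 1` internally disjoint paths between `x` and `y` in `H`. -/
theorem stmt_2 {V : Type*} [Fintype V] (G : SimpleGraph V)
    (p q m : ℕ) (hm : 4 ≤ m) (hp : 3 ≤ p)
    (part : V → Fin p)
    (hsize : ∀ i : Fin p, {v : V | part v = i}.ncard = q)
    (hreg : ∀ v : V, {w : V | G.Adj v w ∧ part w = part v}.ncard = m)
    (hconn : ∀ i : Fin p, IsKConnected m (G.induce {v : V | part v = i}))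
    (hout : ∀ v : V, ∃ w₁ w₂ : V, w₁ ≠ w₂ ∧ G.Adj v w₁ ∧ G.Adj v w₂ ∧
      part w₁ ≠ part v ∧ part w₂ ≠ part v ∧ part w₁ ≠ part w₂ ∧
      (∀ w : V, G.Adj v w → part w ≠ part v → w = w₁ ∨ w = w₂))
    (hcross : ∀ i j : Fin p, i ≠ j →
      {e : V × V | G.Adj e.1 e.2 ∧ part e.1 = i ∧ part e.2 = j}.ncard * (p - 1) = 2 * q ∧
      m + 2 ≤ {e : V × V | G.Adj e.1 e.2 ∧ part e.1 = i ∧ part e.2 = j}.ncard)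
    (i j : Fin p) (hij : i ≠ j)
    (x y : ↥{v : V | part v = i ∨ part v = j})
    (hx : part (x : V) = i) (hy : part (y : V) = j)
    (hdx : ((G.induce {v : V | part v = i ∨ part v = j}).neighborSet x).ncard = m + 1)
    (hdy : ((G.induce {v : V | part v = i ∨ part v = j}).neighborSet y).ncard = m + 1) :
    InternallyDisjointPaths (G.induce {v : V | part v = i ∨ part v = j}) (m + 1) x y := by
  have huniq : ∀ v w w', G.Adj v w → G.Adj v w' → part w ≠ part v → part w = part w' →
      w = w' := by
    intro v w w' h h' hne heq
    obtain ⟨w₁, w₂, -, -, -, -, -, hne', hall⟩ := hout v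
    rcases hall w h hne with rfl | rfl <;> rcases hall w' h' (heq ▸ hne) with rfl | rfl
    · rfl
    · exact absurd heq hne'
    · exact absurd heq.symm hne'
    · rfl
  have hxy : x ≠ y := by
    rintro rfl
    exact hij (hx.symm.trans hy)
  by_cases hadj : (G.induce {v : V | part v = i ∨ part v = j}).Adj x y
  · exact ⟨fun _ => hadj.toWalk, fun _ => by simp [hxy], by simp⟩
  refine internallyDisjointPaths_of_separators hxy hadj fun S hS hxS hyS => ?_
  have hlt : ∀ k, (∃ v ∈ S, part (v : V) ≠ k) →
      {v : {v : V | part v = i ∨ part v = j} |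
        v ∈ (S : Set _) ∧ (v : V) ∈ {v : V | part v = k}}.ncard < m := by
    rintro k ⟨v, hv, hvk⟩
    have := Set.ncard_lt_ncard (s := {v : {v : V | part v = i ∨ part v = j} |
        v ∈ (S : Set _) ∧ (v : V) ∈ {v : V | part v = k}})
      (t := S) (LE.le.ssubset_of_mem_notMem (fun v hv => hv.1) hv fun h => hvk h.2)
    rw [Set.ncard_coe_finset] at this
    omega
  have hlt' : ∀ k, (∀ v ∈ S, part (v : V) ≠ k) →
      {v : {v : V | part v = i ∨ part v = j} |
        v ∈ (S : Set _) ∧ (v : V) ∈ {v : V | part v = k}}.ncard < m := by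
    intro k h
    refine lt_of_eq_of_lt ?_ (by omega : 0 < m)
    rw [Set.ncard_eq_zero]
    exact Set.eq_empty_of_forall_notMem fun v hv => h v hv.1 hv.2
  have hwi := fun h u v => (hconn i).exists_walk (W := {v : V | part v = i ∨ part v = j})
    (fun _ => Or.inl) (T := S) h (u := u) (v := v)
  have hwj := fun h u v => (hconn j).exists_walk (W := {v : V | part v = i ∨ part v = j})
    (fun _ => Or.inr) (T := S) h (u := u) (v := v)
  by_cases hSj : ∀ v ∈ S, part (v : V) ≠ j
  · obtain ⟨x', hx', hpart⟩ := exists_adj_of_ncard_lt part x (hreg x) (by omega)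
    have hx'j : part (x' : V) = j := x'.2.resolve_left fun h => hpart (h.trans hx.symm)
    obtain ⟨w, hw⟩ := hwj (hlt' j hSj) x' y hx'j hy (fun h => hSj _ h hx'j) hyS
    exact ⟨.cons hx' w, by simpa [hxS] using hw⟩
  by_cases hSi : ∀ v ∈ S, part (v : V) ≠ i
  · obtain ⟨y', hy', hpart⟩ := exists_adj_of_ncard_lt part y (hreg y) (by omega)
    have hy'i : part (y' : V) = i := y'.2.resolve_right fun h => hpart (h.trans hy.symm)
    obtain ⟨w, hw⟩ := hwi (hlt' i hSi) x y' hx hy'i hxS (fun h => hSi _ h hy'i)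
    refine ⟨w.concat hy'.symm, fun v hv => ?_⟩
    rw [Walk.support_concat, List.mem_append, List.mem_singleton] at hv
    rcases hv with hv | rfl
    · exact hw v hv
    · exact hyS
  push Not at hSi hSj
  obtain ⟨si, hsi, hsi'⟩ := hSi
  obtain ⟨sj, hsj, hsj'⟩ := hSj
  obtain ⟨⟨u, v⟩, ⟨huv, hu, hv⟩, huS, hvS⟩ := exists_edge_of_ncard_lt
    (E := {e : V × V | G.Adj e.1 e.2 ∧ part e.1 = i ∧ part e.2 = j})
    (T := Subtype.val '' (S : Set {v : V | part v = i ∨ part v = j}))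
    (by
      have := Set.ncard_image_le (f := Subtype.val)
        (s := (S : Set {v : V | part v = i ∨ part v = j}))
      rw [Set.ncard_coe_finset] at this
      have := (hcross i j hij).2
      omega)
    (by
      rintro ⟨u, v⟩ ⟨h, hu, hv⟩ ⟨u', v'⟩ ⟨h', hu', hv'⟩ heq
      dsimp only at *
      subst heq
      rw [huniq u v v' h h' (by rw [hu, hv]; exact hij.symm) (hv.trans hv'.symm)])
    (by
      rintro ⟨u, v⟩ ⟨h, hu, hv⟩ ⟨u', v'⟩ ⟨h', hu', hv'⟩ heq
      dsimp only at *
      subst heq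
      rw [huniq v u u' h.symm h'.symm (by rw [hu, hv]; exact hij) (hu.trans hu'.symm)])
    (by
      rintro e ⟨-, hu, -⟩ e' ⟨-, -, hv'⟩ heq
      exact hij (by rw [← hu, heq, hv']))
  dsimp only at huv hu hv huS hvS
  obtain ⟨w₁, hw₁⟩ := hwi (hlt i ⟨sj, hsj, by rw [hsj']; exact hij.symm⟩) x ⟨u, Or.inl hu⟩ hx hu
    hxS fun h => huS ⟨_, h, rfl⟩
  obtain ⟨w₂, hw₂⟩ := hwj (hlt j ⟨si, hsi, by rw [hsi']; exact hij⟩) ⟨v, Or.inr hv⟩ y hv hy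
    (fun h => hvS ⟨_, h, rfl⟩) hyS
  have huv' : (G.induce {v : V | part v = i ∨ part v = j}).Adj ⟨u, Or.inl hu⟩ ⟨v, Or.inr hv⟩ :=
    huv
  refine ⟨w₁.append (.cons huv' w₂), fun z hz => ?_⟩
  rw [Walk.mem_support_append_iff, Walk.support_cons, List.mem_cons] at hz
  rcases hz with hz | rfl | hz
  · exact hw₁ z hz
  · exact hw₁ _ (by simp)
  · exact hw₂ z hz
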